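/- arXiv:math/0404352 — 2 statements merged into one kernel-verified Lean document; each statement's English description precedes it below -/
import Mathlib

section
/- Let (W,S) be a finite Coxeter system. The weak Bruhat order ≤_B on P^{(W,S)} is antisymmetric, i.e. the reflexive-transitive closure of the generating relations (1) and (2) is a partial order on the set P^{(W,S)} of right coclasses; in particular there is no nontrivial cycle of coclasses obtained by applying the relations (1) and (2). -/
namespace PaperWeakBruhat

variable {B W : Type*} [Group W] {M : CoxeterMatrix B}

/-- The weak Bruhat order on `W`: `x ≤_B x'` iff `x' = y * x` with `ℓ(x') = ℓ(y) + ℓ(x)`. -/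
noncomputable def weakLE (cs : CoxeterSystem M W) (x x' : W) : Prop :=
  ∃ y : W, x' = y * x ∧ cs.length x' = cs.length y + cs.length x

/-- The standard parabolic subgroup `W_J` generated by the simple reflections in `J`. -/
def parabolic (cs : CoxeterSystem M W) (J : Set B) : Subgroup W :=
  Subgroup.closure (cs.simple '' J)

/-- The Solomon subset `X_J` of elements having no descent at `J`. -/
noncomputable def solomon (cs : CoxeterSystem M W) (J : Set B) : Set W :=
  {w : W | ∀ s ∈ J, cs.length w < cs.length (w * cs.simple s)}

/-- The right coclass `W_J ∘ w`, as a subset of `W`. -/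
def coclass (cs : CoxeterSystem M W) (J : Set B) (w : W) : Set W :=
  {x : W | ∃ p ∈ parabolic cs J, x = p * w}

/-- The generating relations of the weak Bruhat order on the set `P^{(W,S)}` of right
coclasses of standard parabolic subgroups:
(1) `W_J ∘ w <_B W_{J∪{s}} ∘ w` and (2) `W_{J∪{s}} ∘ w <_B W_J ∘ (α_{J,s}⁻¹ ∘ w)`,
for `J ⊆ S`, `s ∈ S ∖ J` and `w ∈ X_{J∪{s}}⁻¹`, where `α_{J,s} = ξ_{J∪{s}}⁻¹ ∘ ξ_J`.
Here `ξ : Set B → W` is the family of longest elements of the Solomon sets `X_J`. -/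
noncomputable def pRel (cs : CoxeterSystem M W) (ξ : Set B → W) :
    Set W → Set W → Prop := fun A C =>
  ∃ (J : Set B) (s : B) (w : W), s ∉ J ∧ w⁻¹ ∈ solomon cs (J ∪ {s}) ∧
    ((A = coclass cs J w ∧ C = coclass cs (J ∪ {s}) w) ∨
     (A = coclass cs (J ∪ {s}) w ∧
        C = coclass cs J (((ξ (J ∪ {s}))⁻¹ * ξ J)⁻¹ * w)))

lemma functionEnd_mul_apply {α : Type*} (f g : Function.End α) (x : α) : (f * g) x = f (g x) := rfl

lemma functionEnd_one_apply {α : Type*} (x : α) : (1 : Function.End α) x = x := rfl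

/-- The action of the `i`-th simple reflection on pairs of a group element and a sign. -/
noncomputable def signStep (cs : CoxeterSystem M W) (i : B) : Function.End (W × ZMod 2) :=
  open Classical in fun q =>
    (cs.simple i * q.1 * cs.simple i, q.2 + if q.1 = cs.simple i then 1 else 0)

open Classical in
lemma signStep_mul_pow_apply (cs : CoxeterSystem M W) (i j : B) (n : ℕ) (q : W × ZMod 2) :
    ((signStep cs i * signStep cs j) ^ n) q =
      ((cs.simple i * cs.simple j) ^ n * q.1 * ((cs.simple i * cs.simple j) ^ n)⁻¹,
        q.2 + ∑ k ∈ Finset.range (2 * n),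
          if q.1 = cs.simple j * (cs.simple i * cs.simple j) ^ k then 1 else 0) := by
  induction n with
  | zero => simp [functionEnd_one_apply]
  | succ n ih =>
    rw [pow_succ', functionEnd_mul_apply, ih]
    set p := cs.simple i * cs.simple j with hp
    have hpinv : p⁻¹ = cs.simple j * cs.simple i := by simp [hp]
    have hconj : ∀ k : ℕ, cs.simple j * p ^ k * cs.simple j = (p ^ k)⁻¹ := by
      intro k
      have h := conj_pow (i := k) (a := cs.simple j) (b := p)
      rw [cs.inv_simple] at h
      rw [← h, ← inv_pow, hpinv]
      simp [hp, mul_assoc]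
    have hcomm : ∀ k : ℕ, (p ^ k)⁻¹ * cs.simple j = cs.simple j * p ^ k := by
      intro k
      rw [← hconj k]
      simp
    have h1 : p ^ n * q.1 * (p ^ n)⁻¹ = cs.simple j ↔ q.1 = cs.simple j * p ^ (2 * n) := by
      rw [two_mul, pow_add, ← mul_assoc, ← hcomm, mul_inv_eq_iff_eq_mul, mul_assoc,
        eq_inv_mul_iff_mul_eq]
    have h2 : cs.simple j * (p ^ n * q.1 * (p ^ n)⁻¹) * cs.simple j = cs.simple i ↔
        q.1 = cs.simple j * p ^ (2 * n + 1) := by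
      have h3 : cs.simple j * p ^ (2 * n + 1) =
          (p ^ n)⁻¹ * (cs.simple j * cs.simple i * cs.simple j) * p ^ n := by
        rw [show 2 * n + 1 = n + 1 + n by ring, pow_add, pow_succ, ← mul_assoc, ← mul_assoc,
          ← hcomm]
        simp [hp, mul_assoc]
      rw [h3, ← mul_inv_eq_iff_eq_mul, eq_inv_mul_iff_mul_eq]
      constructor
      · intro h
        rw [← h]
        simp [mul_assoc]
      · intro h
        rw [← mul_assoc] at h
        rw [h]
        simp [mul_assoc]
    rw [show 2 * (n + 1) = 2 * n + 1 + 1 by ring, Finset.sum_range_succ, Finset.sum_range_succ]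
    simp only [signStep, functionEnd_mul_apply, h1, h2, Prod.mk.injEq]
    refine ⟨?_, by ring⟩
    rw [pow_succ']
    simp [hp, mul_assoc]

lemma isLiftable_signStep (cs : CoxeterSystem M W) : M.IsLiftable (signStep cs) := by
  classical
  intro i j
  funext q
  have hp := cs.simple_mul_simple_pow i j
  rw [signStep_mul_pow_apply, two_mul, Finset.sum_range_add]
  simp [pow_add, hp, CharTwo.add_self_eq_zero, functionEnd_one_apply]

/-- The action of `W` on pairs of a group element and a sign. -/
noncomputable def signAction (cs : CoxeterSystem M W) : W →* Function.End (W × ZMod 2) :=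
  cs.lift ⟨signStep cs, isLiftable_signStep cs⟩

lemma signAction_simple (cs : CoxeterSystem M W) (i : B) :
    signAction cs (cs.simple i) = signStep cs i :=
  cs.lift_apply_simple (isLiftable_signStep cs) i

open Classical in
lemma signAction_wordProd (cs : CoxeterSystem M W) (l : List B) (q : W × ZMod 2) :
    signAction cs (cs.wordProd l) q =
      (cs.wordProd l * q.1 * (cs.wordProd l)⁻¹, q.2 + (cs.rightInvSeq l).count q.1) := by
  induction l with
  | nil => simp [functionEnd_one_apply]
  | cons i l ih =>
    rw [cs.wordProd_cons, map_mul, functionEnd_mul_apply, ih,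
      signAction_simple]
    have h : cs.wordProd l * q.1 * (cs.wordProd l)⁻¹ = cs.simple i ↔
        (cs.wordProd l)⁻¹ * cs.simple i * cs.wordProd l = q.1 := by
      rw [mul_inv_eq_iff_eq_mul, mul_assoc, inv_mul_eq_iff_eq_mul, eq_comm]
    simp only [signStep, CoxeterSystem.rightInvSeq, List.count_cons, h, beq_iff_eq,
      Prod.mk.injEq]
    refine ⟨by simp [mul_assoc], ?_⟩
    push_cast
    ring

/-- The exchange property. -/
lemma exists_eraseIdx_of_isRightDescent (cs : CoxeterSystem M W) (l : List B) (i : B)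
    (h : cs.IsRightDescent (cs.wordProd l) i) :
    ∃ k < l.length, cs.wordProd l * cs.simple i = cs.wordProd (l.eraseIdx k) := by
  classical
  suffices hmem : cs.simple i ∈ cs.rightInvSeq l by
    obtain ⟨k, hk, hki⟩ := List.mem_iff_getElem.mp hmem
    refine ⟨k, by simpa using hk, ?_⟩
    rw [← cs.wordProd_mul_getD_rightInvSeq, List.getD_eq_getElem _ 1 hk, hki]
  by_contra hmem
  obtain ⟨l', hl', hw⟩ := cs.exists_isReduced (cs.wordProd l * cs.simple i)
  have hmem' : cs.simple i ∉ cs.rightInvSeq l' := by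
    intro hm
    have := (cs.isRightInversion_of_mem_rightInvSeq hl' hm).2
    rw [← hw, cs.simple_mul_simple_cancel_right] at this
    exact lt_asymm h this
  have h1 := signAction_wordProd cs l' (cs.simple i, 0)
  have h2 := signAction_wordProd cs l (cs.simple i, 1)
  rw [← hw, map_mul, functionEnd_mul_apply, signAction_simple] at h1
  simp only [signStep, cs.simple_mul_simple_self, one_mul, if_true, zero_add] at h1
  rw [h2, List.count_eq_zero.mpr hmem, List.count_eq_zero.mpr hmem'] at h1
  simp at h1

lemma wordProd_mem_parabolic (cs : CoxeterSystem M W) {J : Set B} {l : List B}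
    (hl : ∀ i ∈ l, i ∈ J) : cs.wordProd l ∈ parabolic cs J := by
  refine Subgroup.list_prod_mem _ fun x hx => ?_
  obtain ⟨i, hi, rfl⟩ := List.mem_map.mp hx
  exact Subgroup.subset_closure ⟨i, hl i hi, rfl⟩

lemma exists_word_of_mem_parabolic (cs : CoxeterSystem M W) {J : Set B} {x : W}
    (hx : x ∈ parabolic cs J) : ∃ l : List B, (∀ i ∈ l, i ∈ J) ∧ cs.wordProd l = x := by
  induction hx using Subgroup.closure_induction with
  | mem x hx =>
    obtain ⟨i, hi, rfl⟩ := hx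
    exact ⟨[i], by simpa using hi, by simp⟩
  | one => exact ⟨[], by simp, by simp⟩
  | mul x y _ _ hx hy =>
    obtain ⟨l, hl, rfl⟩ := hx
    obtain ⟨l', hl', rfl⟩ := hy
    refine ⟨l ++ l', fun i hi => ?_, cs.wordProd_append l l'⟩
    exact (List.mem_append.mp hi).elim (hl i) (hl' i)
  | inv x _ hx =>
    obtain ⟨l, hl, rfl⟩ := hx
    exact ⟨l.reverse, fun i hi => hl i (List.mem_reverse.mp hi), cs.wordProd_reverse l⟩

lemma parabolic_mono (cs : CoxeterSystem M W) {J K : Set B} (h : J ⊆ K) :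
    parabolic cs J ≤ parabolic cs K :=
  Subgroup.closure_mono (Set.image_mono h)

/-- A right descent of an element of `W_J` is a simple reflection lying in `W_J`. -/
lemma simple_mem_parabolic_of_isRightDescent (cs : CoxeterSystem M W) {J : Set B} {x : W} {i : B}
    (hx : x ∈ parabolic cs J) (h : cs.IsRightDescent x i) : cs.simple i ∈ parabolic cs J := by
  obtain ⟨l, hl, rfl⟩ := exists_word_of_mem_parabolic cs hx
  obtain ⟨k, -, hk⟩ := exists_eraseIdx_of_isRightDescent cs l i h
  have := wordProd_mem_parabolic cs (l := l.eraseIdx k)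
    (fun i hi => hl i (List.mem_of_mem_eraseIdx hi))
  rw [← hk] at this
  exact (Subgroup.mul_mem_cancel_left _ hx).mp this

/-- Lengths add on `y * W_J` when `y` has minimal length in that coset. -/
lemma length_mul_wordProd_of_minimal (cs : CoxeterSystem M W) {J : Set B} {y : W}
    (hy : ∀ p ∈ parabolic cs J, cs.length y ≤ cs.length (y * p)) (l : List B)
    (hl : ∀ i ∈ l, i ∈ J) :
    cs.length (y * cs.wordProd l) = cs.length y + cs.length (cs.wordProd l) := by
  induction hn : l.length using Nat.strong_induction_on generalizing l with
  | _ n ih =>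
    obtain rfl | ⟨l', i, rfl⟩ := l.eq_nil_or_concat'
    · simp
    have hl' : ∀ j ∈ l', j ∈ J := fun j hj => hl j (by simp [hj])
    have hp : cs.wordProd (l' ++ [i]) = cs.wordProd l' * cs.simple i := by
      simp [cs.wordProd_append]
    have hlen : l'.length + 1 = n := by simpa using hn
    have ih' := ih l'.length (by lia) l' hl' rfl
    have hshort : ∀ k < l'.length,
        cs.wordProd l' * cs.simple i = cs.wordProd (l'.eraseIdx k) →
        cs.length (y * cs.wordProd (l' ++ [i])) =
          cs.length y + cs.length (cs.wordProd (l' ++ [i])) := by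
      intro k hk h
      rw [hp, h]
      have := List.length_eraseIdx_add_one hk
      exact ih (l'.eraseIdx k).length (by lia) _
        (fun j hj => hl' j (List.mem_of_mem_eraseIdx hj)) rfl
    by_cases h1 : cs.IsRightDescent (cs.wordProd l') i
    · obtain ⟨k, hk, h⟩ := exists_eraseIdx_of_isRightDescent cs l' i h1
      exact hshort k hk h
    by_cases h2 : cs.IsRightDescent (y * cs.wordProd l') i
    · obtain ⟨ly, hly, rfl⟩ := cs.exists_isReduced y
      rw [← cs.wordProd_append] at h2
      obtain ⟨k, hk, h⟩ := exists_eraseIdx_of_isRightDescent cs _ i h2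
      by_cases hkl : k < ly.length
      · exfalso
        rw [List.eraseIdx_append_of_lt_length hkl, cs.wordProd_append, cs.wordProd_append] at h
        have h3 : cs.wordProd (ly.eraseIdx k) =
            cs.wordProd ly * (cs.wordProd l' * cs.simple i * (cs.wordProd l')⁻¹) := by
          rw [← mul_assoc, ← mul_assoc, h, mul_inv_cancel_right]
        have h4 := hy (cs.wordProd l' * cs.simple i * (cs.wordProd l')⁻¹)
          (mul_mem (hp ▸ wordProd_mem_parabolic cs hl)
            (inv_mem (wordProd_mem_parabolic cs hl')))
        rw [← h3, hly.eq] at h4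
        have h5 := cs.length_wordProd_le (ly.eraseIdx k)
        have := List.length_eraseIdx_add_one hkl
        lia
      · rw [List.eraseIdx_append_of_length_le (not_lt.mp hkl), cs.wordProd_append,
          cs.wordProd_append, mul_assoc] at h
        rw [List.length_append] at hk
        exact hshort (k - ly.length) (by lia) (mul_left_cancel h)
    · rw [cs.not_isRightDescent_iff] at h1 h2
      rw [hp, ← mul_assoc, h2, ih', h1, add_assoc]

lemma exists_isRightDescent_of_mem_parabolic (cs : CoxeterSystem M W) {J : Set B} {x : W}
    (hx : x ∈ parabolic cs J) (h1 : x ≠ 1) : ∃ i ∈ J, cs.IsRightDescent x i := by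
  obtain ⟨l, hl, rfl⟩ := exists_word_of_mem_parabolic cs hx
  induction hn : l.length using Nat.strong_induction_on generalizing l with
  | _ n ih =>
    obtain rfl | ⟨l', i, rfl⟩ := l.eq_nil_or_concat'
    · simp at h1
    have hlen : l'.length + 1 = n := by simpa using hn
    have hp : cs.wordProd (l' ++ [i]) = cs.wordProd l' * cs.simple i := by
      simp [cs.wordProd_append]
    by_cases h2 : cs.IsRightDescent (cs.wordProd l') i
    · obtain ⟨k, hk, h⟩ := exists_eraseIdx_of_isRightDescent cs l' i h2
      have := List.length_eraseIdx_add_one hk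
      rw [hp, h] at h1 hx ⊢
      exact ih (l'.eraseIdx k).length (by lia) _
        (fun j hj => hl j (List.mem_append_left _ (List.mem_of_mem_eraseIdx hj))) hx h1 rfl
    · refine ⟨i, hl i (by simp), ?_⟩
      rw [hp, cs.isRightDescent_iff_not_isRightDescent_mul, cs.simple_mul_simple_cancel_right]
      exact h2

lemma length_mul_of_mem_solomon (cs : CoxeterSystem M W) {J : Set B} {x p : W}
    (hx : x ∈ solomon cs J) (hp : p ∈ parabolic cs J) :
    cs.length (x * p) = cs.length x + cs.length p := by
  suffices hmin : ∀ p ∈ parabolic cs J, cs.length x ≤ cs.length (x * p) by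
    obtain ⟨l, hl, rfl⟩ := exists_word_of_mem_parabolic cs hp
    exact length_mul_wordProd_of_minimal cs hmin l hl
  obtain ⟨p₀, hp₀, hmin⟩ := WellFounded.has_min
    (measure fun p => cs.length (x * p)).wf (parabolic cs J : Set W) ⟨1, one_mem _⟩
  have hmin' : ∀ p ∈ parabolic cs J, cs.length (x * p₀) ≤ cs.length (x * p) :=
    fun p hp => not_lt.mp (hmin p hp)
  obtain rfl | hne := eq_or_ne p₀ 1
  · simpa using hmin'
  exfalso
  have hadd : ∀ p ∈ parabolic cs J,
      cs.length (x * p₀ * p) = cs.length (x * p₀) + cs.length p := by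
    intro p hp
    obtain ⟨l, hl, rfl⟩ := exists_word_of_mem_parabolic cs hp
    refine length_mul_wordProd_of_minimal cs (fun p hp => ?_) l hl
    rw [mul_assoc]
    exact hmin' _ (mul_mem hp₀ hp)
  obtain ⟨i, hi, hdesc⟩ :=
    exists_isRightDescent_of_mem_parabolic cs (inv_mem hp₀) (inv_ne_one.mpr hne)
  have h1 := hadd p₀⁻¹ (inv_mem hp₀)
  have h2 := hadd (p₀⁻¹ * cs.simple i)
    (mul_mem (inv_mem hp₀) (Subgroup.subset_closure ⟨i, hi, rfl⟩))
  rw [mul_inv_cancel_right] at h1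
  rw [← mul_assoc, mul_inv_cancel_right] at h2
  have h3 := hx i hi
  have h4 : cs.length (p₀⁻¹ * cs.simple i) < cs.length p₀⁻¹ := hdesc
  lia

lemma length_mul_of_inv_mem_solomon (cs : CoxeterSystem M W) {J : Set B} {w p : W}
    (hw : w⁻¹ ∈ solomon cs J) (hp : p ∈ parabolic cs J) :
    cs.length (p * w) = cs.length p + cs.length w := by
  have := length_mul_of_mem_solomon cs hw (inv_mem hp)
  rwa [← mul_inv_rev, cs.length_inv, cs.length_inv, cs.length_inv, add_comm] at this

/-- A standard parabolic subgroup is determined inside a larger one by the maximal length. -/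
lemma parabolic_eq_of_length_le (cs : CoxeterSystem M W) {J K : Set B} {x : W} (hJK : J ⊆ K)
    (hx : x ∈ parabolic cs J) (hmax : ∀ y ∈ parabolic cs K, cs.length y ≤ cs.length x) :
    parabolic cs J = parabolic cs K := by
  refine le_antisymm (parabolic_mono cs hJK) ((Subgroup.closure_le _).mpr ?_)
  rintro _ ⟨i, hi, rfl⟩
  refine simple_mem_parabolic_of_isRightDescent cs hx
    (lt_of_le_of_ne ?_ (cs.length_mul_simple_ne x i))
  exact hmax _ (mul_mem (parabolic_mono cs hJK hx) (Subgroup.subset_closure ⟨i, hi, rfl⟩))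

lemma coclass_eq_of_parabolic_eq (cs : CoxeterSystem M W) {J K : Set B} (w : W)
    (h : parabolic cs J = parabolic cs K) : coclass cs J w = coclass cs K w := by
  simp only [coclass, h]

lemma coclass_mul_left (cs : CoxeterSystem M W) {J : Set B} {p : W} (w : W)
    (hp : p ∈ parabolic cs J) : coclass cs J (p * w) = coclass cs J w := by
  ext x
  constructor
  · rintro ⟨q, hq, rfl⟩
    exact ⟨q * p, mul_mem hq hp, (mul_assoc _ _ _).symm⟩
  · rintro ⟨q, hq, rfl⟩
    exact ⟨q * p⁻¹, mul_mem hq (inv_mem hp), by simp [mul_assoc]⟩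

/-- The sum of the extreme lengths in a set of group elements. -/
noncomputable def rank (cs : CoxeterSystem M W) (A : Set W) : ℕ :=
  sInf (cs.length '' A) + sSup (cs.length '' A)

lemma rank_eq (cs : CoxeterSystem M W) {A : Set W} {m n : ℕ}
    (hm : IsLeast (cs.length '' A) m) (hn : IsGreatest (cs.length '' A) n) :
    rank cs A = m + n := by
  rw [rank, hm.csInf_eq, hn.csSup_eq]

lemma isLeast_length_coclass (cs : CoxeterSystem M W) {J : Set B} {w : W}
    (hw : w⁻¹ ∈ solomon cs J) : IsLeast (cs.length '' coclass cs J w) (cs.length w) := by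
  refine ⟨⟨w, ⟨1, one_mem _, by simp⟩, rfl⟩, ?_⟩
  rintro _ ⟨_, ⟨p, hp, rfl⟩, rfl⟩
  simp [length_mul_of_inv_mem_solomon cs hw hp]

lemma isGreatest_length_coclass (cs : CoxeterSystem M W) {J : Set B} {w x : W}
    (hw : w⁻¹ ∈ solomon cs J) (hx : x ∈ parabolic cs J)
    (hmax : ∀ y ∈ parabolic cs J, cs.length y ≤ cs.length x) :
    IsGreatest (cs.length '' coclass cs J w) (cs.length x + cs.length w) := by
  refine ⟨⟨x * w, ⟨x, hx, rfl⟩, length_mul_of_inv_mem_solomon cs hw hx⟩, ?_⟩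
  rintro _ ⟨_, ⟨p, hp, rfl⟩, rfl⟩
  rw [length_mul_of_inv_mem_solomon cs hw hp]
  exact Nat.add_le_add_right (hmax p hp) _

lemma solomon_anti (cs : CoxeterSystem M W) {J K : Set B} (h : J ⊆ K) :
    solomon cs K ⊆ solomon cs J :=
  fun _ hw s hs => hw s (h hs)

lemma rank_lt_or_eq_of_coclass_subset (cs : CoxeterSystem M W) {J K : Set B} {w x y : W}
    (hJK : J ⊆ K) (hw : w⁻¹ ∈ solomon cs K) (hx : x ∈ parabolic cs J)
    (hxmax : ∀ z ∈ parabolic cs J, cs.length z ≤ cs.length x) (hy : y ∈ parabolic cs K)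
    (hymax : ∀ z ∈ parabolic cs K, cs.length z ≤ cs.length y) :
    rank cs (coclass cs J w) < rank cs (coclass cs K w) ∨ coclass cs J w = coclass cs K w := by
  have hwJ := solomon_anti cs hJK hw
  rw [rank_eq cs (isLeast_length_coclass cs hwJ) (isGreatest_length_coclass cs hwJ hx hxmax),
    rank_eq cs (isLeast_length_coclass cs hw) (isGreatest_length_coclass cs hw hy hymax)]
  by_cases h : cs.length y ≤ cs.length x
  · exact Or.inr (coclass_eq_of_parabolic_eq cs w
      (parabolic_eq_of_length_le cs hJK hx fun z hz => (hymax z hz).trans h))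
  · left
    lia

lemma rank_lt_or_eq_of_subset_coclass (cs : CoxeterSystem M W) {J K : Set B} {w x y : W}
    (hJK : J ⊆ K) (hw : w⁻¹ ∈ solomon cs K) (hx : x ∈ parabolic cs J)
    (hy : y ∈ parabolic cs K)
    (hymax : ∀ z ∈ parabolic cs K, cs.length z ≤ cs.length y) :
    rank cs (coclass cs K w) < rank cs (coclass cs J (x * y⁻¹ * w)) ∨
      coclass cs K w = coclass cs J (x * y⁻¹ * w) := by
  rw [mul_assoc, coclass_mul_left cs _ hx]
  have hgreat := isGreatest_length_coclass cs hw hy hymax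
  have hsub : coclass cs J (y⁻¹ * w) ⊆ coclass cs K w := by
    rintro _ ⟨p, hp, rfl⟩
    exact ⟨p * y⁻¹, mul_mem (parabolic_mono cs hJK hp) (inv_mem hy), (mul_assoc _ _ _).symm⟩
  have hmem : y⁻¹ * w ∈ coclass cs J (y⁻¹ * w) := ⟨1, one_mem _, by simp⟩
  have hgreat' : IsGreatest (cs.length '' coclass cs J (y⁻¹ * w))
      (cs.length y + cs.length w) := by
    refine ⟨⟨_, hmem, ?_⟩, fun n hn => hgreat.2 (Set.image_mono hsub hn)⟩
    rw [length_mul_of_inv_mem_solomon cs hw (inv_mem hy), cs.length_inv]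
  obtain ⟨_, ⟨p, hp, rfl⟩, hpm⟩ := Nat.sInf_mem (s := cs.length '' coclass cs J (y⁻¹ * w))
    ⟨_, _, hmem, rfl⟩
  rw [← mul_assoc, length_mul_of_inv_mem_solomon cs hw
    (mul_mem (parabolic_mono cs hJK hp) (inv_mem hy))] at hpm
  by_cases h : cs.length (p * y⁻¹) = 0
  · right
    have hpy : p = y := mul_inv_eq_one.mp (cs.length_eq_zero_iff.mp h)
    subst hpy
    rw [coclass_mul_left cs _ (inv_mem hp)]
    exact (coclass_eq_of_parabolic_eq cs w (parabolic_eq_of_length_le cs hJK hp hymax)).symm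
  · left
    rw [rank_eq cs (isLeast_length_coclass cs hw) hgreat, rank, hgreat'.csSup_eq, ← hpm]
    lia

/-- the weak Bruhat order on `P^{(W,S)}` (the reflexive-transitive closure of the
generating relations (1) and (2)) is antisymmetric; in particular there is no nontrivial cycle
of coclasses obtained by applying the generating relations. -/
theorem pOrder_antisymm [Finite W] (cs : CoxeterSystem M W)
    (ωS : W) (ωf ξ : Set B → W)
    (hS : ∀ w : W, cs.length w ≤ cs.length ωS)
    (hω : ∀ J : Set B, ωf J ∈ parabolic cs J ∧
      ∀ x ∈ parabolic cs J, cs.length x ≤ cs.length (ωf J))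
    (hξ : ∀ J : Set B, ξ J ∈ solomon cs J ∧ ωS = ξ J * ωf J) :
    ∀ A C : Set W, Relation.ReflTransGen (pRel cs ξ) A C →
      Relation.ReflTransGen (pRel cs ξ) C A → A = C := by
  have step : ∀ A C, pRel cs ξ A C → rank cs A < rank cs C ∨ A = C := by
    rintro A C ⟨J, s, w, -, hw, ⟨rfl, rfl⟩ | ⟨rfl, rfl⟩⟩
    · exact rank_lt_or_eq_of_coclass_subset cs Set.subset_union_left hw (hω J).1 (hω J).2
        (hω _).1 (hω _).2
    · have hα : ((ξ (J ∪ {s}))⁻¹ * ξ J)⁻¹ = ωf J * (ωf (J ∪ {s}))⁻¹ := by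
        rw [eq_mul_inv_of_mul_eq (hξ J).2.symm, eq_mul_inv_of_mul_eq (hξ (J ∪ {s})).2.symm]
        group
      rw [hα]
      exact rank_lt_or_eq_of_subset_coclass cs Set.subset_union_left hw (hω J).1
        (hω _).1 (hω _).2
  have chain : ∀ A C, Relation.ReflTransGen (pRel cs ξ) A C → rank cs A < rank cs C ∨ A = C := by
    intro A C h
    induction h with
    | refl => exact Or.inr rfl
    | tail _ h ih =>
      rcases ih with ih | rfl
      · rcases step _ _ h with h | rfl
        · exact Or.inl (ih.trans h)
        · exact Or.inl ih
      · exact step _ _ h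
  intro A C hAC hCA
  rcases chain A C hAC with h | h
  · rcases chain C A hCA with h' | h'
    · exact absurd h' h.asymm
    · exact h'.symm
  · exact h

end PaperWeakBruhat
end

section
/- For any composition (n₁,…,n_r) of n, the set of shuffles SH(n₁,…,n_r) equals {ω ∈ P_n : ω ≤_B ξ_{n₁,…,n_r}}, where ξ_{n₁,…,n_r} is the maximal (n₁,…,n_r)-shuffle permutation and ≤_B is the weak Bruhat order on P_n. -/
namespace PaperP

/-- `IsPF n r f` : `f` represents a surjective map `{1,…,n} → {1,…,r}` (an element of
`P_{n,r}`), normalized so that `f v = 0` for `v ∉ {1,…,n}`. -/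
def IsPF (n r : ℕ) (f : ℕ → ℕ) : Prop :=
  (∀ v : ℕ, f v ≠ 0 ↔ (1 ≤ v ∧ v ≤ n)) ∧ f '' Set.Icc 1 n = Set.Icc 1 r

/-- The product `γ × δ ∈ P_{n+m,r+s}` of `γ ∈ P_{n,r}` and `δ ∈ P_{m,s}`:
`(γ×δ)(i) = γ(i)` for `1 ≤ i ≤ n` and `(γ×δ)(n+i) = δ(i)+r` for `1 ≤ i ≤ m`. -/
def prodF (n r : ℕ) (f g : ℕ → ℕ) : ℕ → ℕ := fun v =>
  if v ≤ n then f v else if g (v - n) = 0 then 0 else g (v - n) + r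

/-- The identity map `1_r` of `{1,…,r}`. -/
def idF (r : ℕ) : ℕ → ℕ := fun v => if 1 ≤ v ∧ v ≤ r then v else 0

/-- The map `t_i ∈ P_{r,r-1}` : `t_i(j) = j` for `j ≤ i` and `t_i(j) = j-1` for `j > i`. -/
def tF (r i : ℕ) : ℕ → ℕ := fun v =>
  if 1 ≤ v ∧ v ≤ r then (if v ≤ i then v else v - 1) else 0

/-- The block-increasing condition: `γ` is increasing on each of the consecutive blocks of
sizes `ns = (n₁,…,n_r)` (positions are 1-based). -/
def BlockIncr (ns : List ℕ) (f : ℕ → ℕ) : Prop :=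
  ∀ j < ns.length, ∀ a b : ℕ, (ns.take j).sum < a → a < b → b ≤ (ns.take (j + 1)).sum →
    f a < f b

/-- Membership in the set of shuffles `SH(n₁,…,n_r) ⊆ P_n`, `n = n₁+…+n_r`. -/
def InSH (ns : List ℕ) (f : ℕ → ℕ) : Prop :=
  (∃ r : ℕ, IsPF ns.sum r f) ∧ BlockIncr ns f

/-- `γ⁻¹(i) < γ⁻¹(i+1)` : every element of `γ⁻¹(i)` is smaller than every element of
`γ⁻¹(i+1)`. -/
def InvIncr (f : ℕ → ℕ) (i : ℕ) : Prop := ∀ a b : ℕ, f a = i → f b = i + 1 → a < b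

/-- `γ⁻¹(i) > γ⁻¹(i+1)` : every element of `γ⁻¹(i)` is larger than every element of
`γ⁻¹(i+1)`. -/
def InvDecr (f : ℕ → ℕ) (i : ℕ) : Prop := ∀ a b : ℕ, f a = i → f b = i + 1 → b < a

/-- One covering step of the weak Bruhat order on `P_n` :
`γ <_B t_i ∘ γ` when `γ⁻¹(i) < γ⁻¹(i+1)`, and `t_i ∘ γ <_B γ` when `γ⁻¹(i) > γ⁻¹(i+1)`,
for `γ ∈ P_{n,r}` and `1 ≤ i ≤ r-1`. -/
def BStep (n : ℕ) (f g : ℕ → ℕ) : Prop :=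
  ∃ r i : ℕ, 1 ≤ i ∧ i + 1 ≤ r ∧
    ((IsPF n r f ∧ InvIncr f i ∧ g = tF r i ∘ f) ∨
     (IsPF n r g ∧ InvDecr g i ∧ f = tF r i ∘ g))

/-- The weak Bruhat order `≤_B` on `P_n`, the reflexive-transitive closure of `BStep`. -/
def BLE (n : ℕ) : (ℕ → ℕ) → (ℕ → ℕ) → Prop := Relation.ReflTransGen (BStep n)

/-- Turn a (1-based) list of values into a normalized map `ℕ → ℕ`. -/
def ofList (l : List ℕ) : ℕ → ℕ := fun v => if v = 0 then 0 else l.getD (v - 1) 0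

/-- The maximal shuffle `ξ_{n₁,…,n_r}` :
`ξ(k) = k - (n₁+…+n_{j-1}) + (n_{j+1}+…+n_r)` for `n₁+…+n_{j-1} < k ≤ n₁+…+n_j`. -/
def xiF : List ℕ → ℕ → ℕ
  | [], _ => 0
  | m :: rest, k =>
      if k = 0 then 0 else if k ≤ m then k + rest.sum else xiF rest (k - m)

/-- The list `z(n₀,…,n_k) = (1,…,n₀, n+1, n₀+1,…,n₀+n₁, n+1, …, n+1, n₀+…+n_{k-1}+1,…,n)`
where `n = n₀+…+n_k` (built with an accumulator `start`). -/
def zList (n : ℕ) : ℕ → List ℕ → List ℕ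
  | _, [] => []
  | start, [m] => List.range' (start + 1) m
  | start, m :: rest => List.range' (start + 1) m ++ (n + 1) :: zList n (start + m) rest

/-- `z(n₀,…,n_k)` as a normalized map. -/
def zF (ns : List ℕ) : ℕ → ℕ := ofList (zList ns.sum 0 ns)

/-- The iterated product `γ₀ × … × γ_k` of a family, each member given as a triple
`(nᵢ, rᵢ, γᵢ)` with `γᵢ ∈ P_{nᵢ,rᵢ}`; returns `(Σnᵢ, Σrᵢ, γ₀×…×γ_k)`. -/
def prodFam : List (ℕ × ℕ × (ℕ → ℕ)) → ℕ × ℕ × (ℕ → ℕ)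
  | [] => (0, 0, fun _ => 0)
  | (n, r, f) :: rest =>
      let p := prodFam rest
      (n + p.1, r + p.2.1, prodF n r f p.2.2)

/-- The wedge `⋁_ω(γ₀,…,γ_k) = ((ω ∘ (γ₀×…×γ_k)) × 1₁) ∘ z(n₀,…,n_k)` of a family
`γᵢ ∈ P_{nᵢ,rᵢ}` over a shuffle `ω ∈ SH(r₀,…,r_k)`. -/
def wedgeF (ω : ℕ → ℕ) (fam : List (ℕ × ℕ × (ℕ → ℕ))) : ℕ → ℕ :=
  prodF (prodFam fam).1 (prodFam fam).2.1 (ω ∘ (prodFam fam).2.2) (idF 1) ∘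
    zF (fam.map (·.1))

theorem isPF_iff {n r : ℕ} {f : ℕ → ℕ} :
    IsPF n r f ↔ (∀ v, ¬(1 ≤ v ∧ v ≤ n) → f v = 0) ∧
      (∀ v, 1 ≤ v → v ≤ n → 1 ≤ f v ∧ f v ≤ r) ∧
      ∀ u, 1 ≤ u → u ≤ r → ∃ v, 1 ≤ v ∧ v ≤ n ∧ f v = u := by
  constructor
  · rintro ⟨h0, him⟩
    refine ⟨fun v hv => by_contra fun h => hv ((h0 v).1 h), fun v h1 h2 => ?_, fun u h1 h2 => ?_⟩
    · have : f v ∈ Set.Icc 1 r := him ▸ Set.mem_image_of_mem f ⟨h1, h2⟩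
      exact this
    · have : u ∈ f '' Set.Icc 1 n := him ▸ ⟨h1, h2⟩
      obtain ⟨v, ⟨hv1, hv2⟩, hv⟩ := this
      exact ⟨v, hv1, hv2, hv⟩
  · rintro ⟨h0, hr, hs⟩
    refine ⟨fun v => ⟨fun h => by_contra fun hv => h (h0 v hv), fun ⟨h1, h2⟩ => ?_⟩, ?_⟩
    · have := hr v h1 h2
      omega
    · ext u
      constructor
      · rintro ⟨v, ⟨h1, h2⟩, rfl⟩
        exact hr v h1 h2
      · rintro ⟨h1, h2⟩
        obtain ⟨v, hv1, hv2, hv⟩ := hs u h1 h2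
        exact ⟨v, ⟨hv1, hv2⟩, hv⟩

theorem IsPF.le {n r : ℕ} {f : ℕ → ℕ} (hf : IsPF n r f) (v : ℕ) : f v ≤ r := by
  obtain ⟨h0, hr, -⟩ := isPF_iff.1 hf
  by_cases hv : 1 ≤ v ∧ v ≤ n
  · exact (hr v hv.1 hv.2).2
  · simp [h0 v hv]

theorem IsPF.le_of_lt_imp_lt {n r s : ℕ} {f g : ℕ → ℕ} (hf : IsPF n r f) (hg : IsPF n s g)
    (h : ∀ a b, 1 ≤ a → a ≤ n → 1 ≤ b → b ≤ n → f a < f b → g a < g b) (v : ℕ) :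
    f v ≤ g v := by
  obtain ⟨hf0, hfr, hfs⟩ := isPF_iff.1 hf
  obtain ⟨-, hgr, -⟩ := isPF_iff.1 hg
  have key : ∀ m v, 1 ≤ v → v ≤ n → f v = m → m ≤ g v := by
    intro m
    induction m with
    | zero => intros; omega
    | succ m ih =>
      intro v h1 h2 hv
      rcases Nat.eq_zero_or_pos m with rfl | hm
      · exact (hgr v h1 h2).1
      · obtain ⟨w, hw1, hw2, hw⟩ := hfs m hm (by have := hfr v h1 h2; omega)
        have := ih w hw1 hw2 hw
        have := h w v hw1 hw2 h1 h2 (by omega)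
        omega
  by_cases hv : 1 ≤ v ∧ v ≤ n
  · exact key _ v hv.1 hv.2 rfl
  · simp [hf0 v hv]

/-- The index of the block of `ns` containing the position `k`. -/
def blockIdx : List ℕ → ℕ → ℕ
  | [], _ => 0
  | m :: rest, k => if k ≤ m then 0 else blockIdx rest (k - m) + 1

theorem blockIdx_eq_iff (ns : List ℕ) (j k : ℕ) (h1 : 1 ≤ k) (h2 : k ≤ ns.sum) :
    blockIdx ns k = j ↔ j < ns.length ∧ (ns.take j).sum < k ∧ k ≤ (ns.take (j + 1)).sum := by
  induction ns generalizing j k with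
  | nil => simp at h2; omega
  | cons m rest ih =>
    simp only [List.sum_cons] at h2
    by_cases hk : k ≤ m
    · cases j with
      | zero => simp [blockIdx, hk]; omega
      | succ j => simp [blockIdx, hk]; omega
    · cases j with
      | zero => simp [blockIdx, hk]
      | succ j =>
        have := ih j (k - m) (by omega) (by omega)
        simp [blockIdx, hk, this]
        omega

theorem blockIdx_mono (ns : List ℕ) : Monotone (blockIdx ns) := by
  induction ns with
  | nil => intro a b _; simp [blockIdx]
  | cons m rest ih =>
    intro a b hab
    have := ih (show a - m ≤ b - m by omega)
    simp only [blockIdx]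
    split_ifs <;> omega

theorem blockIncr_iff {ns : List ℕ} {f : ℕ → ℕ} :
    BlockIncr ns f ↔ ∀ a b, 1 ≤ a → a < b → b ≤ ns.sum → blockIdx ns a = blockIdx ns b →
      f a < f b := by
  constructor
  · intro h a b h1 hab h2 he
    have ha := (blockIdx_eq_iff ns _ a h1 (by omega)).1 rfl
    have hb := (blockIdx_eq_iff ns _ b (by omega) h2).1 he.symm
    exact h _ ha.1 a b ha.2.1 hab hb.2.2
  · intro h j hj a b ha hab hb
    have hs : (ns.take (j + 1)).sum ≤ ns.sum := (List.take_sublist _ _).sum_le_sum (by simp)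
    refine h a b (by omega) hab (by omega) ?_
    rw [(blockIdx_eq_iff ns j a (by omega) (by omega)).2 ⟨hj, ha, by omega⟩,
      (blockIdx_eq_iff ns j b (by omega) (by omega)).2 ⟨hj, by omega, hb⟩]

theorem isPF_xiF (ns : List ℕ) : IsPF ns.sum ns.sum (xiF ns) := by
  induction ns with
  | nil => exact isPF_iff.2 ⟨fun _ _ => rfl, fun v h1 h2 => by simp at h2; omega,
      fun v h1 h2 => by simp at h2; omega⟩
  | cons m rest ih =>
    obtain ⟨h0, hr, hs⟩ := isPF_iff.1 ih
    refine isPF_iff.2 ⟨fun v hv => ?_, fun v h1 h2 => ?_, fun u h1 h2 => ?_⟩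
    · simp only [List.sum_cons] at hv
      simp only [xiF]
      split_ifs with ha hb
      · rfl
      · omega
      · exact h0 _ (by omega)
    · simp only [List.sum_cons] at h2 ⊢
      simp only [xiF]
      split_ifs with ha hb
      · omega
      · omega
      · have := hr (v - m) (by omega) (by omega)
        omega
    · simp only [List.sum_cons] at h2 ⊢
      by_cases hu : u ≤ rest.sum
      · obtain ⟨v, hv1, hv2, hv⟩ := hs u h1 hu
        refine ⟨v + m, by omega, by omega, ?_⟩
        rw [xiF, if_neg (by omega), if_neg (by omega), Nat.add_sub_cancel, hv]
      · refine ⟨u - rest.sum, by omega, by omega, ?_⟩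
        rw [xiF, if_neg (by omega), if_pos (by omega)]
        omega

theorem xiF_lt_or_lt (ns : List ℕ) (a b : ℕ) (h1 : 1 ≤ a) (hab : a < b) (h2 : b ≤ ns.sum) :
    (blockIdx ns a = blockIdx ns b ∧ xiF ns a < xiF ns b) ∨
      (blockIdx ns a < blockIdx ns b ∧ xiF ns b < xiF ns a) := by
  induction ns generalizing a b with
  | nil => simp at h2; omega
  | cons m rest ih =>
    simp only [List.sum_cons] at h2
    have hle := (isPF_xiF rest).le (b - m)
    have ha0 : a ≠ 0 := by omega
    have hb0 : b ≠ 0 := by omega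
    simp only [xiF, blockIdx, ha0, hb0, if_false]
    by_cases ha : a ≤ m
    · by_cases hb : b ≤ m
      · simp [ha, hb, hab]
      · simp only [ha, hb, if_true, if_false]
        omega
    · have := ih (a - m) (b - m) (by omega) (by omega) (by omega)
      have hb : ¬ b ≤ m := by omega
      simpa [ha, hb] using this

theorem BStep.blockIncr {ns : List ℕ} {f g : ℕ → ℕ} (h : BStep ns.sum f g)
    (hg : BlockIncr ns g) : BlockIncr ns f := by
  intro j hj a b ha hab hb
  have hlt := hg j hj a b ha hab hb
  obtain ⟨r, i, hi, hir, ⟨hf, -, rfl⟩ | ⟨hg', hinv, rfl⟩⟩ := h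
  · have := hf.le a
    simp only [Function.comp, tF] at hlt
    split_ifs at hlt <;> omega
  · have h1 := hg'.le a
    have h2 := hg'.le b
    have h3 := (hg'.1 a).2 ⟨by omega, by
      have hs : (ns.take (j + 1)).sum ≤ ns.sum := (List.take_sublist _ _).sum_le_sum (by simp)
      omega⟩
    have h4 := hinv a b
    simp only [Function.comp, tF]
    split_ifs <;> omega

theorem BLE.blockIncr {ns : List ℕ} {f g : ℕ → ℕ} (h : BLE ns.sum f g)
    (hg : BlockIncr ns g) : BlockIncr ns f := by
  induction h using Relation.ReflTransGen.head_induction_on with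
  | refl => exact hg
  | head hs _ ih => exact hs.blockIncr ih

/-- A pair of positions contributes `2`, `1` or `0` according to whether `f` is increasing,
constant or decreasing on it. -/
def pairScore (f : ℕ → ℕ) (p : ℕ × ℕ) : ℕ :=
  if p.1 < p.2 then (if f p.1 < f p.2 then 2 else if f p.1 = f p.2 then 1 else 0) else 0

/-- The total score of the pairs of positions in `{1,…,n}`. -/
def totalScore (n : ℕ) (f : ℕ → ℕ) : ℕ :=
  ∑ p ∈ Finset.Icc 1 n ×ˢ Finset.Icc 1 n, pairScore f p

theorem totalScore_lt {n : ℕ} {f g : ℕ → ℕ} {a b : ℕ} (ha : a ∈ Finset.Icc 1 n)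
    (hb : b ∈ Finset.Icc 1 n)
    (hle : ∀ x y, 1 ≤ x → x < y → y ≤ n → pairScore g (x, y) ≤ pairScore f (x, y))
    (hlt : pairScore g (a, b) < pairScore f (a, b)) : totalScore n g < totalScore n f := by
  refine Finset.sum_lt_sum ?_ ⟨(a, b), Finset.mem_product.2 ⟨ha, hb⟩, hlt⟩
  rintro ⟨x, y⟩ hp
  simp only [Finset.mem_product, Finset.mem_Icc] at hp
  by_cases hxy : x < y
  · exact hle x y hp.1.1 hxy hp.2.2
  · simp [pairScore, hxy]

/-- A shuffle which is not injective can be raised by splitting a level set. -/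
theorem exists_bStep_of_not_injOn {ns : List ℕ} {f : ℕ → ℕ} {r a b : ℕ}
    (hf : IsPF ns.sum r f) (hinc : BlockIncr ns f) (h1 : 1 ≤ a) (hab : a < b)
    (h2 : b ≤ ns.sum) (he : f a = f b) :
    ∃ g, BStep ns.sum f g ∧ InSH ns g ∧ totalScore ns.sum g < totalScore ns.sum f := by
  classical
  obtain ⟨h0, hr, hs⟩ := isPF_iff.1 hf
  have hex : ∃ v, f v = f a := ⟨a, rfl⟩
  obtain ⟨p, hp, hmin⟩ : ∃ p, f p = f a ∧ ∀ v, f v = f a → p ≤ v :=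
    ⟨Nat.find hex, Nat.find_spec hex, fun v hv => Nat.find_min' hex hv⟩
  have hpa := hmin a rfl
  have hai := hr a h1 (by omega)
  have hp1 := (hf.1 p).1 (by omega)
  generalize f a = i at *
  set g : ℕ → ℕ := fun v => if i < f v ∨ v = p then f v + 1 else f v with hg
  have hgt : ∀ v, i < f v → g v = f v + 1 := fun v hv => if_pos (Or.inl hv)
  have hgp : g p = i + 1 := by simp [hg, hp]
  have hgl : ∀ v, v ≠ p → f v ≤ i → g v = f v := fun v hv hv' =>
    if_neg (by rintro (h | h); exacts [absurd h (by omega), hv h])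
  have hcases : ∀ v, (v = p ∧ f v = i ∧ g v = i + 1) ∨ (v ≠ p ∧ i < f v ∧ g v = f v + 1) ∨
      (v ≠ p ∧ f v ≤ i ∧ g v = f v) := by
    intro v
    by_cases hv : v = p
    · left; subst hv; exact ⟨rfl, hp, hgp⟩
    · rcases Nat.lt_or_ge i (f v) with h | h
      · exact Or.inr (Or.inl ⟨hv, h, hgt v h⟩)
      · exact Or.inr (Or.inr ⟨hv, h, hgl v hv h⟩)
  have hgPF : IsPF ns.sum (r + 1) g := by
    refine isPF_iff.2 ⟨fun v hv => ?_, fun v hv1 hv2 => ?_, fun u hu1 hu2 => ?_⟩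
    · have := h0 v hv
      have := hcases v
      omega
    · have := hr v hv1 hv2
      have := hcases v
      omega
    · rcases lt_trichotomy u i with hu | hu | hu
      · obtain ⟨v, hv1, hv2, hv⟩ := hs u hu1 (by omega)
        exact ⟨v, hv1, hv2, by have := hcases v; omega⟩
      · exact ⟨b, by omega, h2, by have := hcases b; omega⟩
      · by_cases hu' : u = i + 1
        · exact ⟨p, hp1.1, hp1.2, by omega⟩
        · obtain ⟨v, hv1, hv2, hv⟩ := hs (u - 1) (by omega) (by omega)
          exact ⟨v, hv1, hv2, by have := hcases v; omega⟩
  refine ⟨g, ⟨r + 1, i, hai.1, by omega, Or.inr ⟨hgPF, ?_, ?_⟩⟩, ⟨⟨_, hgPF⟩, ?_⟩, ?_⟩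
  · intro x y hx hy
    have hx' := hcases x
    have hy' := hcases y
    have := hmin x
    omega
  · funext v
    have := hcases v
    have := hf.le v
    simp only [Function.comp, tF]
    split_ifs <;> omega
  · intro j hj x y hx hxy hy
    have := hinc j hj x y hx hxy hy
    have := hcases x
    have := hcases y
    omega
  · refine totalScore_lt (a := p) (b := b) (Finset.mem_Icc.2 hp1)
      (Finset.mem_Icc.2 ⟨by omega, h2⟩) (fun x y _ hxy _ => ?_) ?_
    · have := hcases x
      have := hcases y
      have := hmin x
      simp only [pairScore]
      split_ifs <;> omega
    · have := hcases b
      simp only [pairScore]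
      split_ifs <;> omega

/-- An injective shuffle having a non-inverted pair in distinct blocks has such a pair with
consecutive values. -/
theorem exists_consecutive {ns : List ℕ} {f : ℕ → ℕ} {r : ℕ} (hf : IsPF ns.sum r f) (d : ℕ) :
    ∀ a b, 1 ≤ a → b ≤ ns.sum → blockIdx ns a < blockIdx ns b → f b = f a + 1 + d →
      ∃ x y, 1 ≤ x ∧ y ≤ ns.sum ∧ blockIdx ns x < blockIdx ns y ∧ f y = f x + 1 := by
  induction d using Nat.strong_induction_on with
  | _ d ih =>
    intro a b h1 h2 hlt hd
    rcases Nat.eq_zero_or_pos d with rfl | hpos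
    · exact ⟨a, b, h1, h2, hlt, hd⟩
    · have hle := hf.le b
      obtain ⟨c, hc1, hc2, hc⟩ := (isPF_iff.1 hf).2.2 (f a + 1) (by omega) (by omega)
      by_cases hac : blockIdx ns a < blockIdx ns c
      · exact ⟨a, c, h1, hc2, hac, hc⟩
      · exact ih (d - 1) (by omega) c b hc1 h2 (by omega) (by omega)

/-- An injective shuffle can be raised by merging two levels of consecutive values whose
elements lie in distinct blocks. -/
theorem exists_bStep_of_injOn {ns : List ℕ} {f : ℕ → ℕ} {r a b : ℕ}
    (hf : IsPF ns.sum r f) (hinc : BlockIncr ns f)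
    (hinj : ∀ a b, 1 ≤ a → a < b → b ≤ ns.sum → f a ≠ f b)
    (h1 : 1 ≤ a) (h2 : b ≤ ns.sum) (hblk : blockIdx ns a < blockIdx ns b)
    (hlt : f b = f a + 1) :
    ∃ g, BStep ns.sum f g ∧ InSH ns g ∧ totalScore ns.sum g < totalScore ns.sum f := by
  obtain ⟨h0, hr, hs⟩ := isPF_iff.1 hf
  have hab : a < b := by
    by_contra h
    have := blockIdx_mono ns (show b ≤ a by omega)
    omega
  have hai := hr a h1 (by omega)
  have hbi := hr b (by omega) h2
  have huniq : ∀ x y, 1 ≤ y → y ≤ ns.sum → f x = f y → x = y := by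
    intro x y hy1 hy2 hxy
    have := hr y hy1 hy2
    have := (hf.1 x).1 (by omega)
    rcases lt_trichotomy x y with h | h | h
    · exact absurd hxy (hinj x y this.1 h hy2)
    · exact h
    · exact absurd hxy.symm (hinj y x hy1 h this.2)
  have hua : ∀ x, f x = f a → x = a := fun x => huniq x a h1 (by omega)
  have hub : ∀ x, f x = f a + 1 → x = b := fun x hx => huniq x b (by omega) h2 (by omega)
  generalize hia : f a = i at *
  have hcases : ∀ v, (f v ≤ i ∧ (tF r i ∘ f) v = f v) ∨
      (i < f v ∧ (tF r i ∘ f) v = f v - 1) := by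
    intro v
    have := hf.le v
    simp only [Function.comp, tF]
    split_ifs <;> omega
  refine ⟨tF r i ∘ f, ⟨r, i, hai.1, by omega, Or.inl ⟨hf, ?_, rfl⟩⟩, ⟨⟨r - 1, ?_⟩, ?_⟩, ?_⟩
  · intro x y hx hy
    rw [hua x hx, hub y hy]
    exact hab
  · refine isPF_iff.2 ⟨fun v hv => ?_, fun v hv1 hv2 => ?_, fun u hu1 hu2 => ?_⟩
    · have := h0 v hv
      have := hcases v
      omega
    · have := hr v hv1 hv2
      have := hcases v
      omega
    · by_cases hu : u ≤ i
      · obtain ⟨v, hv1, hv2, hv⟩ := hs u hu1 (by omega)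
        exact ⟨v, hv1, hv2, by have := hcases v; omega⟩
      · obtain ⟨v, hv1, hv2, hv⟩ := hs (u + 1) (by omega) (by omega)
        exact ⟨v, hv1, hv2, by have := hcases v; omega⟩
  · rw [blockIncr_iff] at hinc ⊢
    intro x y hx hxy hy he
    have := hinc x y hx hxy hy he
    have := hcases x
    have := hcases y
    by_cases hxi : f x = i ∧ f y = i + 1
    · rw [hua x hxi.1, hub y hxi.2] at he
      omega
    · omega
  · refine totalScore_lt (a := a) (b := b) (Finset.mem_Icc.2 ⟨h1, by omega⟩)
      (Finset.mem_Icc.2 ⟨by omega, h2⟩) (fun x y _ hxy _ => ?_) ?_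
    · have := hcases x
      have := hcases y
      have := hua y
      have := hub x
      simp only [pairScore]
      split_ifs <;> omega
    · have hca := hcases a
      have hcb := hcases b
      simp only [pairScore]
      split_ifs <;> omega

theorem InSH.eq_xiF {ns : List ℕ} {f : ℕ → ℕ} (hf : InSH ns f)
    (h : ∀ a b, 1 ≤ a → b ≤ ns.sum → blockIdx ns a < blockIdx ns b → f b < f a) :
    f = xiF ns := by
  obtain ⟨⟨r, hr⟩, hinc⟩ := hf
  rw [blockIncr_iff] at hinc
  have hiff : ∀ a b, 1 ≤ a → a ≤ ns.sum → 1 ≤ b → b ≤ ns.sum →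
      (f a < f b ↔ xiF ns a < xiF ns b) := by
    intro a b ha1 ha2 hb1 hb2
    rcases lt_trichotomy a b with hab | rfl | hab
    · rcases xiF_lt_or_lt ns a b ha1 hab hb2 with ⟨he, hx⟩ | ⟨hl, hx⟩
      · have := hinc a b ha1 hab hb2 he
        omega
      · have := h a b ha1 hb2 hl
        omega
    · simp
    · rcases xiF_lt_or_lt ns b a hb1 hab ha2 with ⟨he, hx⟩ | ⟨hl, hx⟩
      · have := hinc b a hb1 hab ha2 he
        omega
      · have := h b a hb1 ha2 hl
        omega
  funext v
  exact le_antisymm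
    (hr.le_of_lt_imp_lt (isPF_xiF ns) (fun a b h1 h2 h3 h4 => (hiff a b h1 h2 h3 h4).1) v)
    ((isPF_xiF ns).le_of_lt_imp_lt hr (fun a b h1 h2 h3 h4 => (hiff a b h1 h2 h3 h4).2) v)

theorem blockIncr_xiF (ns : List ℕ) : BlockIncr ns (xiF ns) :=
  blockIncr_iff.2 fun a b h1 hab h2 he => by
    have := xiF_lt_or_lt ns a b h1 hab h2
    omega

/-- A shuffle is below the maximal one in the weak Bruhat order. -/
theorem InSH.ble_xiF {ns : List ℕ} {f : ℕ → ℕ} (hf : InSH ns f) : BLE ns.sum f (xiF ns) := by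
  induction hN : totalScore ns.sum f using Nat.strong_induction_on generalizing f with
  | _ N ih =>
    subst hN
    by_cases hmax : f = xiF ns
    · rw [hmax]
      exact Relation.ReflTransGen.refl
    suffices ∃ g, BStep ns.sum f g ∧ InSH ns g ∧ totalScore ns.sum g < totalScore ns.sum f by
      obtain ⟨g, hstep, hg, hlt⟩ := this
      exact Relation.ReflTransGen.head hstep (ih _ hlt hg rfl)
    obtain ⟨⟨r, hr⟩, hinc⟩ := id hf
    by_cases hinj : ∀ a b, 1 ≤ a → a < b → b ≤ ns.sum → f a ≠ f b
    · by_contra hno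
      refine hmax (hf.eq_xiF fun a b h1 h2 hblk => ?_)
      by_contra hle
      have hab : a < b := by
        by_contra h
        have := blockIdx_mono ns (show b ≤ a by omega)
        omega
      have hne := hinj a b h1 hab h2
      obtain ⟨x, y, hx, hy, hxy, he⟩ :=
        exists_consecutive hr (f b - f a - 1) a b h1 h2 hblk (by omega)
      exact hno (exists_bStep_of_injOn hr hinc hinj hx hy hxy he)
    · push Not at hinj
      obtain ⟨a, b, h1, hab, h2, he⟩ := hinj
      exact exists_bStep_of_not_injOn hr hinc h1 hab h2 he

/-- for any composition `(n₁,…,n_r)` of `n`, the set of shuffles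
`SH(n₁,…,n_r)` equals `{ω ∈ P_n : ω ≤_B ξ_{n₁,…,n_r}}`. -/
theorem shuffles_eq_weak_interval (ns : List ℕ) (hne : ns ≠ [])
    (hpos : ∀ x ∈ ns, 1 ≤ x) :
    {ω : ℕ → ℕ | InSH ns ω} =
    {ω : ℕ → ℕ | (∃ s : ℕ, IsPF ns.sum s ω) ∧ BLE ns.sum ω (xiF ns)} := by
  ext ω
  exact ⟨fun h => ⟨h.1, h.ble_xiF⟩, fun h => ⟨h.1, h.2.blockIncr (blockIncr_xiF ns)⟩⟩

end PaperP
end
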